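/- arXiv:1905.00343 — 2 statements merged into one kernel-verified Lean document; each statement's English description precedes it below -/
import Mathlib

section
/- For every integer n ≥ 1 define the convex body C_n = {(x,y) ∈ ℝ² : |x| ≤ (2n)!/(n!·3^{n/2}) and |x·e³ − y| ≤ (3/2)^{2n}/(n!·3^{n/2})} (where e³ is the real exponential of 3), and the lattice Λ_n = {(x,y) ∈ ℤ² : |x·E₃ − y|₃ ≤ 3^{-n}}, where E₃ = Σ_{k≥0} 3^k/k! ∈ ℚ₃ is the 3-adic exponential of 3 and |·|₃ the 3-adic absolute value on ℚ₃. For i = 1, 2 let λ_i(C_n, Λ_n) be the smallest λ > 0 such that λ·C_n contains at least i elements of Λ_n that are linearly independent over ℚ. Then there exists a constant c > 1, independent of n, such that for all n ≥ 1: (c·n²)^{-1} ≤ λ₁(C_n, Λ_n) ≤ λ₂(C_n, Λ_n) ≤ c·n². -/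
open scoped Pointwise

instance : Fact (Nat.Prime 3) := ⟨by norm_num⟩

/-- The 3-adic exponential of 3, i.e. `Σ_{k≥0} 3^k/k!` in `ℚ₃`. -/
noncomputable def E3 : ℚ_[3] := ∑' k : ℕ, (3 ^ k / (k.factorial : ℚ_[3]))

/-- The convex body `C_n ⊆ ℝ²`. -/
noncomputable def Cbody (n : ℕ) : Set (ℝ × ℝ) :=
  {p | |p.1| ≤ (2 * n).factorial / (n.factorial * (3 : ℝ) ^ ((n : ℝ) / 2)) ∧
       |p.1 * Real.exp 3 - p.2| ≤ (3 / 2 : ℝ) ^ (2 * n) / (n.factorial * (3 : ℝ) ^ ((n : ℝ) / 2))}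

/-- The lattice `Λ_n ⊆ ℤ²` of pairs `(a, b)` with `|a E₃ − b|₃ ≤ 3^{-n}`. -/
noncomputable def Lat3 (n : ℕ) : Set (ℝ × ℝ) :=
  {p | ∃ a b : ℤ, p = ((a : ℝ), (b : ℝ)) ∧
    ‖(a : ℚ_[3]) * E3 - (b : ℚ_[3])‖ ≤ (3 : ℝ) ^ (-(n : ℤ))}

/-- `i`-th minimum of `C` with respect to `Λ`: the least `λ > 0` such that `λ • C`
contains at least `i` elements of `Λ` that are linearly independent over `ℚ`. -/
noncomputable def lambdaMin (C L : Set (ℝ × ℝ)) (i : ℕ) : ℝ :=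
  sInf {l : ℝ | 0 < l ∧ ∃ T : Finset (ℝ × ℝ), ↑T ⊆ L ∩ (l • C) ∧ i ≤ T.card ∧
    LinearIndependent ℚ (fun v : T => (v : ℝ × ℝ))}

/-- The integers `∑ k ≤ n, (2n-k)! / (k! (n-k)!) z ^ k`, defined by their recurrence: the numerators
(at `z`) and denominators (at `-z`) of the diagonal Padé approximants of `exp z`. -/
def padeInt (z : ℤ) : ℕ → ℤ
  | 0 => 1
  | 1 => 2 + z
  | n + 2 => (4 * n + 6) * padeInt z (n + 1) + z ^ 2 * padeInt z n

theorem padeInt_det (z : ℤ) (n : ℕ) :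
    padeInt (-z) n * padeInt z (n + 1) - padeInt z n * padeInt (-z) (n + 1) =
      2 * z * (-z ^ 2) ^ n := by
  induction n with
  | zero => simp [padeInt]; ring
  | succ n ih =>
    rw [pow_succ, ← mul_assoc, ← ih]
    simp only [padeInt]
    ring

/-- The coefficient `(2n-k)! / (k! (n-k)!) z ^ k`, for `k ≤ n`. -/
def padeTerm (K : Type*) [Field K] (z : ℤ) (n k : ℕ) : K :=
  n.factorial * ((2 * n - k).choose n : K) * ((z : K) ^ k / k.factorial)

theorem padeTerm_add (K : Type*) [Field K] [CharZero K] (z : ℤ) (j k : ℕ) :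
    padeTerm K z (k + j) k = (k + 2 * j).factorial / (k.factorial * j.factorial) * (z : K) ^ k := by
  have h : 2 * (k + j) - k = (k + j) + j := by omega
  have hc := Nat.add_choose_mul_factorial_mul_factorial (k + j) j
  rw [← Nat.choose_symm_add] at hc
  have hc' : ((k + j + j).choose (k + j) : K) * (k + j).factorial * j.factorial =
      (k + 2 * j).factorial := by
    rw [show k + 2 * j = k + j + j by ring]; exact_mod_cast hc
  have h1 : (k.factorial : K) ≠ 0 := by exact_mod_cast k.factorial_ne_zero
  have h2 : (j.factorial : K) ≠ 0 := by exact_mod_cast j.factorial_ne_zero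
  rw [padeTerm, h, ← hc']
  field_simp

theorem padeTerm_succ_succ (K : Type*) [Field K] [CharZero K] (z : ℤ) (j k : ℕ) :
    padeTerm K z (k + j + 2) (k + 2) =
      (4 * (k + j : ℕ) + 6) * padeTerm K z (k + j + 1) (k + 2) +
        (z : K) ^ 2 * padeTerm K z (k + j) k := by
  have h1 : (k.factorial : K) ≠ 0 := by exact_mod_cast k.factorial_ne_zero
  have e1 := padeTerm_add K z j (k + 2)
  rw [show k + 2 + j = k + j + 2 by ring] at e1
  rw [e1, padeTerm_add]
  have hk1 : (k : K) + 1 ≠ 0 := by exact_mod_cast k.succ_ne_zero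
  have hk2 : (k : K) + 1 + 1 ≠ 0 := by exact_mod_cast (k + 1).succ_ne_zero
  rcases j with _ | j
  · have : padeTerm K z (k + 0 + 1) (k + 2) = 0 := by
      rw [padeTerm, Nat.choose_eq_zero_of_lt (by omega)]; simp
    rw [this]
    simp only [Nat.factorial_succ, Nat.mul_zero, Nat.add_zero, Nat.factorial_zero]
    push_cast
    field_simp
    ring
  · have h2 : (j.factorial : K) ≠ 0 := by exact_mod_cast j.factorial_ne_zero
    have hj1 : (j : K) + 1 ≠ 0 := by exact_mod_cast j.succ_ne_zero
    have e3 := padeTerm_add K z j (k + 2)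
    rw [show k + 2 + j = k + (j + 1) + 1 by ring] at e3
    rw [e3, show k + 2 + 2 * (j + 1) = k + 2 * j + 2 + 1 + 1 by ring,
      show k + 2 + 2 * j = k + 2 * j + 2 by ring, show k + 2 * (j + 1) = k + 2 * j + 2 by ring]
    rw [Nat.factorial_succ (k + 2 * j + 2 + 1), Nat.factorial_succ (k + 2 * j + 2),
      Nat.factorial_succ (k + 1), Nat.factorial_succ k, Nat.factorial_succ j]
    push_cast
    field_simp
    ring

theorem padeTerm_succ_zero (K : Type*) [Field K] [CharZero K] (z : ℤ) (n : ℕ) :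
    padeTerm K z (n + 1) 0 = (4 * n + 2) * padeTerm K z n 0 := by
  have e1 := padeTerm_add K z (n + 1) 0
  have e2 := padeTerm_add K z n 0
  simp only [Nat.zero_add] at e1 e2
  have h2 : (n.factorial : K) ≠ 0 := by exact_mod_cast n.factorial_ne_zero
  have hj1 : (n : K) + 1 ≠ 0 := by exact_mod_cast n.succ_ne_zero
  rw [e1, e2, show 2 * (n + 1) = 2 * n + 1 + 1 by ring]
  simp only [Nat.factorial_succ, Nat.factorial_zero]
  push_cast
  field_simp
  ring

theorem padeTerm_succ_one (K : Type*) [Field K] [CharZero K] (z : ℤ) (n : ℕ) :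
    padeTerm K z (n + 2) 1 = (4 * n + 6) * padeTerm K z (n + 1) 1 := by
  have e1 := padeTerm_add K z (n + 1) 1
  have e2 := padeTerm_add K z n 1
  rw [show 1 + (n + 1) = n + 2 by ring] at e1
  rw [show 1 + n = n + 1 by ring] at e2
  have h2 : (n.factorial : K) ≠ 0 := by exact_mod_cast n.factorial_ne_zero
  have hj1 : (n : K) + 1 ≠ 0 := by exact_mod_cast n.succ_ne_zero
  rw [e1, e2, show 1 + 2 * (n + 1) = 1 + 2 * n + 1 + 1 by ring]
  simp only [Nat.factorial_succ, Nat.factorial_zero]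
  push_cast
  field_simp
  ring

theorem padeInt_eq_sum (K : Type*) [Field K] [CharZero K] (z : ℤ) (n : ℕ) :
    (padeInt z n : K) = ∑ k ∈ Finset.range (n + 1), padeTerm K z n k := by
  induction n using Nat.twoStepInduction with
  | zero => simp [padeInt, padeTerm]
  | one => simp [padeInt, padeTerm, Finset.sum_range_succ]
  | more n ih0 ih1 =>
    have hlast : padeTerm K z (n + 1) (n + 2) = 0 := by
      rw [padeTerm, Nat.choose_eq_zero_of_lt (by omega)]; simp
    have hsum : ∑ k ∈ Finset.range (n + 1), padeTerm K z (n + 2) (k + 2) =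
        (4 * n + 6) * ∑ k ∈ Finset.range (n + 1), padeTerm K z (n + 1) (k + 2) +
          (z : K) ^ 2 * ∑ k ∈ Finset.range (n + 1), padeTerm K z n k := by
      rw [Finset.mul_sum, Finset.mul_sum, ← Finset.sum_add_distrib]
      refine Finset.sum_congr rfl fun k hk => ?_
      obtain ⟨j, rfl⟩ := Nat.exists_eq_add_of_le (Nat.lt_succ_iff.mp (Finset.mem_range.mp hk))
      exact padeTerm_succ_succ K z j k
    have hz := padeTerm_succ_zero K z (n + 1)
    rw [Finset.sum_range_succ', Finset.sum_range_succ', hsum, padeTerm_succ_one, hz, ← ih0,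
      Finset.sum_range_succ (fun k => padeTerm K z (n + 1) (k + 2)), hlast]
    rw [Finset.sum_range_succ', Finset.sum_range_succ'] at ih1
    rw [padeInt]
    push_cast at ih1 ⊢
    rw [ih1]
    ring

/-- The terms of the series `±(Qₙ(3) exp 3 - Pₙ(3))`. -/
def remTerm (K : Type*) [Field K] (n k : ℕ) : K :=
  3 ^ (2 * n + k + 1) * (n + k).factorial / (k.factorial * (2 * n + k + 1).factorial)

theorem remTerm_succ_succ (K : Type*) [Field K] [CharZero K] (n k : ℕ) :
    remTerm K (n + 2) k =
      9 * remTerm K n (k + 2) - (4 * n + 6) * remTerm K (n + 1) (k + 2) := by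
  have h1 : (k.factorial : K) ≠ 0 := by exact_mod_cast k.factorial_ne_zero
  have h2 : ((2 * n + k + 3).factorial : K) ≠ 0 := by exact_mod_cast Nat.factorial_ne_zero _
  have hk1 : (k : K) + 1 ≠ 0 := by exact_mod_cast k.succ_ne_zero
  have hk2 : (k : K) + 1 + 1 ≠ 0 := by exact_mod_cast (k + 1).succ_ne_zero
  have h3 : (2 * n + k + 3 : K) + 1 ≠ 0 := by exact_mod_cast (2 * n + k + 3).succ_ne_zero
  have h4 : (2 * n + k + 3 : K) + 1 + 1 ≠ 0 := by exact_mod_cast (2 * n + k + 4).succ_ne_zero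
  simp only [remTerm]
  rw [show 2 * (n + 2) + k + 1 = 2 * n + k + 3 + 1 + 1 by ring,
    show 2 * (n + 1) + (k + 2) + 1 = 2 * n + k + 3 + 1 + 1 by ring,
    show 2 * n + (k + 2) + 1 = 2 * n + k + 3 by ring, show n + 2 + k = n + k + 2 by ring,
    show n + (k + 2) = n + k + 2 by ring, show n + 1 + (k + 2) = n + k + 2 + 1 by ring]
  rw [Nat.factorial_succ (2 * n + k + 3 + 1), Nat.factorial_succ (2 * n + k + 3),
      Nat.factorial_succ (k + 1), Nat.factorial_succ k, Nat.factorial_succ (n + k + 2)]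
  push_cast
  field_simp
  ring

theorem remTerm_succ_zero (K : Type*) [Field K] [CharZero K] (n : ℕ) :
    (4 * n + 6) * remTerm K (n + 1) 0 = 9 * remTerm K n 0 := by
  have h2 : ((2 * n + 1).factorial : K) ≠ 0 := by exact_mod_cast Nat.factorial_ne_zero _
  have h3 : (2 * n + 1 : K) + 1 ≠ 0 := by exact_mod_cast (2 * n + 1).succ_ne_zero
  have h4 : (2 * n + 1 : K) + 1 + 1 ≠ 0 := by exact_mod_cast (2 * n + 2).succ_ne_zero
  simp only [remTerm, Nat.add_zero]
  rw [show 2 * (n + 1) + 1 = 2 * n + 1 + 1 + 1 by ring, Nat.factorial_succ (2 * n + 1 + 1),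
    Nat.factorial_succ (2 * n + 1), Nat.factorial_succ n]
  push_cast
  simp only [Nat.factorial_zero, Nat.cast_one, one_mul]
  rw [mul_div_assoc', mul_div_assoc', div_eq_div_iff (by simp [*]) (by simp [*])]
  ring

theorem remTerm_succ_one (K : Type*) [Field K] [CharZero K] (n : ℕ) :
    (4 * n + 6) * remTerm K (n + 1) 1 = 9 * remTerm K n 1 := by
  have h2 : ((2 * n + 2).factorial : K) ≠ 0 := by exact_mod_cast Nat.factorial_ne_zero _
  have h3 : (2 * n + 2 : K) + 1 ≠ 0 := by exact_mod_cast (2 * n + 2).succ_ne_zero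
  have h4 : (2 * n + 2 : K) + 1 + 1 ≠ 0 := by exact_mod_cast (2 * n + 3).succ_ne_zero
  simp only [remTerm]
  rw [show 2 * (n + 1) + 1 + 1 = 2 * n + 2 + 1 + 1 by ring, show 2 * n + 1 + 1 = 2 * n + 2 by ring,
    Nat.factorial_succ (2 * n + 2 + 1),
    Nat.factorial_succ (2 * n + 2), Nat.factorial_succ (n + 1)]
  push_cast
  simp only [Nat.factorial_one, Nat.cast_one, one_mul]
  rw [mul_div_assoc', mul_div_assoc', div_eq_div_iff (by simp [*]) (by simp [*])]
  ring

theorem hasSum_remTerm {K : Type*} [Field K] [CharZero K] [TopologicalSpace K]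
    [IsTopologicalRing K] {E : K} (hE : HasSum (fun k : ℕ => (3 : K) ^ k / k.factorial) E) (n : ℕ) :
    HasSum (remTerm K n) ((-1) ^ n * (padeInt (-3) n * E - padeInt 3 n)) := by
  induction n using Nat.twoStepInduction with
  | zero =>
    have h := (hasSum_nat_add_iff' 1).mpr hE
    convert! h using 1
    · funext k
      have h1 : (k.factorial : K) ≠ 0 := by exact_mod_cast k.factorial_ne_zero
      simp only [remTerm, Nat.mul_zero, Nat.zero_add]
      field_simp
    · simp [padeInt]
  | one =>
    have h2 := ((hasSum_nat_add_iff' 2).mpr hE).mul_left 3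
    have h3 := ((hasSum_nat_add_iff' 3).mpr hE).mul_left 2
    convert! h2.sub h3 using 1
    · funext k
      have h1 : (k.factorial : K) ≠ 0 := by exact_mod_cast k.factorial_ne_zero
      have hk1 : (k : K) + 1 ≠ 0 := by exact_mod_cast k.succ_ne_zero
      have hk2 : (k : K) + 1 + 1 ≠ 0 := by exact_mod_cast (k + 1).succ_ne_zero
      have hk3 : (k : K) + 2 + 1 ≠ 0 := by exact_mod_cast (k + 2).succ_ne_zero
      simp only [remTerm]
      rw [show 2 * 1 + k + 1 = k + 1 + 1 + 1 by ring, show k + 3 = k + 1 + 1 + 1 by ring,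
        show 1 + k = k + 1 by ring, show k + 2 = k + 1 + 1 by ring]
      simp only [Nat.factorial_succ]
      push_cast
      field_simp
      ring
    · simp only [padeInt, Finset.sum_range_succ, Finset.sum_range_zero, Nat.factorial]
      push_cast
      field_simp
      ring
  | more n ih0 ih1 =>
    have h := (hasSum_nat_add_iff' 2).mpr ((ih0.mul_left 9).sub (ih1.mul_left (4 * (n : K) + 6)))
    convert! h using 1
    · funext k
      exact remTerm_succ_succ K n k
    · simp only [Finset.sum_range_succ, Finset.sum_range_zero, remTerm_succ_zero,
        remTerm_succ_one, padeInt]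
      push_cast
      ring

theorem two_mul_padicValNat_factorial_le (m : ℕ) : 2 * padicValNat 3 m.factorial ≤ m := by
  have h := sub_one_mul_padicValNat_factorial (p := 3) m
  omega

theorem norm_factorial_three (m : ℕ) :
    ‖(m.factorial : ℚ_[3])‖ = ((3 : ℝ) ^ padicValNat 3 m.factorial)⁻¹ := by
  have h0 : (m.factorial : ℚ_[3]) ≠ 0 := by exact_mod_cast m.factorial_ne_zero
  rw [Padic.norm_eq_zpow_neg_valuation h0, Padic.valuation_natCast, zpow_neg, zpow_natCast]
  norm_num

theorem norm_three_pow_div_factorial_le (m : ℕ) :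
    ‖(3 : ℚ_[3]) ^ m / m.factorial‖ ≤ ((3 : ℝ) ^ (m / 2))⁻¹ := by
  have h3 : ‖(3 : ℚ_[3])‖ = (3 : ℝ)⁻¹ := by simpa using Padic.norm_p (p := 3)
  have h := two_mul_padicValNat_factorial_le m
  rw [norm_div, norm_pow, h3, norm_factorial_three, div_inv_eq_mul, inv_pow,
    inv_mul_le_iff₀ (by positivity), ← div_eq_mul_inv, le_div_iff₀ (by positivity), ← pow_add]
  exact pow_le_pow_right₀ (by norm_num) (by omega)

theorem hasSum_E3 : HasSum (fun k : ℕ => (3 : ℚ_[3]) ^ k / k.factorial) E3 := by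
  refine Summable.hasSum (NonarchimedeanAddGroup.summable_of_tendsto_cofinite_zero ?_)
  rw [Nat.cofinite_eq_atTop]
  refine squeeze_zero_norm norm_three_pow_div_factorial_le ?_
  have h : Filter.Tendsto (fun m : ℕ => ((3 : ℝ) ^ m)⁻¹) Filter.atTop (nhds 0) :=
    (tendsto_pow_atTop_atTop_of_one_lt (by norm_num)).inv_tendsto_atTop
  exact h.comp (Nat.tendsto_div_const_atTop (by norm_num))

theorem norm_natCast_padic_le_one (m : ℕ) : ‖(m : ℚ_[3])‖ ≤ 1 := by
  simpa using Padic.norm_int_le_one (p := 3) (m : ℤ)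

theorem norm_remTerm_le (n k : ℕ) :
    ‖remTerm ℚ_[3] n k‖ ≤ ‖(n.factorial : ℚ_[3])‖ * ((3 : ℝ) ^ n)⁻¹ := by
  have h1 : (k.factorial : ℚ_[3]) ≠ 0 := by exact_mod_cast k.factorial_ne_zero
  have h2 : ((2 * n + k + 1).factorial : ℚ_[3]) ≠ 0 := by exact_mod_cast Nat.factorial_ne_zero _
  have hc : ((n + k).choose n : ℚ_[3]) * n.factorial * k.factorial = (n + k).factorial := by
    have := Nat.add_choose_mul_factorial_mul_factorial n k
    rw [← Nat.choose_symm_add] at this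
    exact_mod_cast this
  have he : remTerm ℚ_[3] n k = (n + k).choose n *
      (n.factorial * (3 ^ (2 * n + k + 1) / (2 * n + k + 1).factorial)) := by
    rw [remTerm, ← hc]
    field_simp
  rw [he, norm_mul, norm_mul]
  refine (mul_le_of_le_one_left (by positivity) (norm_natCast_padic_le_one _)).trans ?_
  refine mul_le_mul_of_nonneg_left ((norm_three_pow_div_factorial_le _).trans ?_) (norm_nonneg _)
  exact inv_anti₀ (by positivity) (pow_le_pow_right₀ (by norm_num) (by omega))

theorem norm_padeInt_mul_E3_sub_le (n : ℕ) :
    ‖(padeInt (-3) n : ℚ_[3]) * E3 - padeInt 3 n‖ ≤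
      ‖(n.factorial : ℚ_[3])‖ * ((3 : ℝ) ^ n)⁻¹ := by
  have h := (hasSum_remTerm hasSum_E3 n).tsum_eq
  have h' : ‖(padeInt (-3) n : ℚ_[3]) * E3 - padeInt 3 n‖ = ‖∑' k, remTerm ℚ_[3] n k‖ := by
    rw [h, norm_mul, norm_pow, norm_neg, norm_one, one_pow, one_mul]
  rw [h']
  exact (IsUltrametricDist.norm_tsum_le _).trans (ciSup_le (norm_remTerm_le n))

theorem norm_padeInt_le (z : ℤ) (hz : ‖(z : ℚ_[3])‖ ≤ ‖(3 : ℚ_[3])‖) (n : ℕ) :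
    ‖(padeInt z n : ℚ_[3])‖ ≤ ‖(n.factorial : ℚ_[3])‖ := by
  rw [padeInt_eq_sum]
  refine IsUltrametricDist.norm_sum_le_of_forall_le_of_nonneg (norm_nonneg _) fun k _ => ?_
  rw [padeTerm, norm_mul, norm_mul, mul_assoc]
  refine mul_le_of_le_one_right (norm_nonneg _) (mul_le_one₀ (norm_natCast_padic_le_one _)
    (norm_nonneg _) ?_)
  have h := norm_three_pow_div_factorial_le k
  rw [norm_div, norm_pow] at h ⊢
  have h1 : ((3 : ℝ) ^ (k / 2))⁻¹ ≤ 1 := inv_le_one_of_one_le₀ (one_le_pow₀ (by norm_num))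
  refine le_trans ?_ (h.trans h1)
  gcongr

theorem pow_padicValNat_dvd_padeInt (z : ℤ) (hz : ‖(z : ℚ_[3])‖ ≤ ‖(3 : ℚ_[3])‖) (n : ℕ) :
    (3 : ℤ) ^ padicValNat 3 n.factorial ∣ padeInt z n := by
  have h := (Padic.norm_int_le_pow_iff_dvd (p := 3) (padeInt z n) (padicValNat 3 n.factorial)).mp
    ((norm_padeInt_le z hz n).trans_eq (by
      rw [norm_factorial_three, zpow_neg, zpow_natCast]; norm_num))
  simpa using h

/-- The point `(a, b)` lies in `Λₙ` and in `l • Cₙ`. -/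
structure MemDilate (n : ℕ) (l : ℝ) (a b : ℤ) : Prop where
  fst_le : |(a : ℝ)| ≤ l * ((2 * n).factorial / (n.factorial * (3 : ℝ) ^ ((n : ℝ) / 2)))
  rem_le : |(a : ℝ) * Real.exp 3 - b| ≤
    l * ((3 / 2 : ℝ) ^ (2 * n) / (n.factorial * (3 : ℝ) ^ ((n : ℝ) / 2)))
  norm_le : ‖(a : ℚ_[3]) * E3 - (b : ℚ_[3])‖ ≤ (3 : ℝ) ^ (-(n : ℤ))

theorem mem_lat_inter_smul_iff (n : ℕ) {l : ℝ} (hl : 0 < l) (p : ℝ × ℝ) :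
    p ∈ Lat3 n ∩ l • Cbody n ↔ ∃ a b : ℤ, p = ((a : ℝ), (b : ℝ)) ∧ MemDilate n l a b := by
  have key : ∀ a b : ℝ, ((a, b) : ℝ × ℝ) ∈ l • Cbody n ↔
      |a| ≤ l * ((2 * n).factorial / (n.factorial * (3 : ℝ) ^ ((n : ℝ) / 2))) ∧
      |a * Real.exp 3 - b| ≤
        l * ((3 / 2 : ℝ) ^ (2 * n) / (n.factorial * (3 : ℝ) ^ ((n : ℝ) / 2))) := by
    intro a b
    have e : l⁻¹ * a * Real.exp 3 - l⁻¹ * b = l⁻¹ * (a * Real.exp 3 - b) := by ring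
    rw [Set.mem_smul_set_iff_inv_smul_mem₀ hl.ne']
    simp only [Cbody, Set.mem_ofPred_eq, Prod.smul_mk, smul_eq_mul]
    rw [e, abs_mul, abs_mul, abs_of_pos (inv_pos.mpr hl), inv_mul_le_iff₀ hl, inv_mul_le_iff₀ hl]
  constructor
  · rintro ⟨⟨a, b, rfl, h⟩, hC⟩
    exact ⟨a, b, rfl, ((key _ _).mp hC).1, ((key _ _).mp hC).2, h⟩
  · rintro ⟨a, b, rfl, h⟩
    exact ⟨⟨a, b, rfl, h.norm_le⟩, (key _ _).mpr ⟨h.fst_le, h.rem_le⟩⟩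

theorem abs_padeInt_le (z : ℤ) (n : ℕ) :
    |(padeInt z n : ℝ)| ≤ Real.exp |(z : ℝ)| * ((2 * n).factorial / n.factorial) := by
  have hc : (n.factorial : ℝ) * (2 * n).choose n = (2 * n).factorial / n.factorial := by
    have h0 : (n.factorial : ℝ) ≠ 0 := by exact_mod_cast n.factorial_ne_zero
    rw [eq_div_iff h0]
    have := Nat.add_choose_mul_factorial_mul_factorial n n
    rw [← two_mul] at this
    rw [← this]
    push_cast
    ring
  rw [padeInt_eq_sum]
  refine (Finset.abs_sum_le_sum_abs _ _).trans ?_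
  have h : ∀ k ∈ Finset.range (n + 1), |padeTerm ℝ z n k| ≤
      ((2 * n).factorial / n.factorial) * (|(z : ℝ)| ^ k / k.factorial) := by
    intro k _
    rw [padeTerm, abs_mul, abs_div, abs_pow, abs_mul, Nat.abs_cast, Nat.abs_cast, Nat.abs_cast,
      ← hc]
    gcongr
    omega
  refine (Finset.sum_le_sum h).trans ?_
  rw [← Finset.mul_sum, mul_comm]
  gcongr
  exact Real.sum_le_exp_of_nonneg (abs_nonneg _) _

theorem hasSum_real_exp_three :
    HasSum (fun k : ℕ => (3 : ℝ) ^ k / k.factorial) (Real.exp 3) := by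
  rw [Real.exp_eq_exp_ℝ]
  exact NormedSpace.expSeries_div_hasSum_exp (3 : ℝ)

theorem remTerm_real_le (n k : ℕ) :
    remTerm ℝ n k ≤ 3 * ((3 / 2) ^ (2 * n) / n.factorial) * (3 ^ k / k.factorial) := by
  have h1 : (0 : ℝ) < k.factorial := by exact_mod_cast k.factorial_pos
  have h2 : (0 : ℝ) < n.factorial := by exact_mod_cast n.factorial_pos
  have h3 : (0 : ℝ) < (2 * n + k + 1).factorial := by exact_mod_cast Nat.factorial_pos _
  -- `(n+k)! / (2n+k+1)!` is largest at `k = 0`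
  have hmono : ((n + k).factorial * (2 * n + 1).factorial : ℝ) ≤
      n.factorial * (2 * n + k + 1).factorial := by
    induction k with
    | zero => simp
    | succ k ih =>
      have ih' := ih (by positivity) (by positivity)
      rw [show n + (k + 1) = n + k + 1 by ring, show 2 * n + (k + 1) + 1 = 2 * n + k + 1 + 1 by ring,
        Nat.factorial_succ (n + k), Nat.factorial_succ (2 * n + k + 1)]
      push_cast
      have : ((n : ℝ) + k + 1) * ((n + k).factorial * (2 * n + 1).factorial) ≤
          (2 * n + k + 1 + 1) * (n.factorial * (2 * n + k + 1).factorial) := by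
        have : (0 : ℝ) ≤ n := n.cast_nonneg
        exact mul_le_mul (by linarith) ih' (by positivity) (by positivity)
      linarith
  have hcentral : (4 : ℝ) ^ n * (n.factorial * n.factorial) ≤ (2 * n + 1).factorial := by
    have hb := Nat.four_pow_le_two_mul_add_one_mul_central_binom n
    have hc := Nat.add_choose_mul_factorial_mul_factorial n n
    rw [← two_mul] at hc
    rw [Nat.factorial_succ, ← hc]
    have := Nat.mul_le_mul_right (n.factorial * n.factorial) hb
    have h' : 4 ^ n * (n.factorial * n.factorial) ≤
        (2 * n + 1) * ((2 * n).choose n * n.factorial * n.factorial) := by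
      refine this.trans_eq ?_
      ring
    exact_mod_cast h'
  have hmain : (4 : ℝ) ^ n * (n.factorial * (n + k).factorial) ≤ (2 * n + k + 1).factorial := by
    have hp : (0 : ℝ) < (2 * n + 1).factorial := by exact_mod_cast Nat.factorial_pos _
    refine le_of_mul_le_mul_right ?_ hp
    calc (4 : ℝ) ^ n * (n.factorial * (n + k).factorial) * (2 * n + 1).factorial
        = 4 ^ n * n.factorial * ((n + k).factorial * (2 * n + 1).factorial) := by ring
      _ ≤ 4 ^ n * n.factorial * (n.factorial * (2 * n + k + 1).factorial) := by gcongr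
      _ = 4 ^ n * (n.factorial * n.factorial) * (2 * n + k + 1).factorial := by ring
      _ ≤ (2 * n + 1).factorial * (2 * n + k + 1).factorial := by gcongr
      _ = _ := by ring
  have e : 3 * ((3 / 2 : ℝ) ^ (2 * n) / n.factorial) * (3 ^ k / k.factorial) =
      3 ^ (2 * n + k + 1) / (4 ^ n * n.factorial * k.factorial) := by
    rw [pow_mul (3 / 2 : ℝ), pow_succ (3 : ℝ), pow_add, pow_mul (3 : ℝ),
      show (3 / 2 : ℝ) ^ 2 = 3 ^ 2 / 4 by norm_num, div_pow]
    field_simp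
  rw [e, remTerm, div_le_div_iff₀ (by positivity) (by positivity)]
  calc (3 : ℝ) ^ (2 * n + k + 1) * (n + k).factorial * (4 ^ n * n.factorial * k.factorial)
      = 3 ^ (2 * n + k + 1) * k.factorial * (4 ^ n * (n.factorial * (n + k).factorial)) := by ring
    _ ≤ 3 ^ (2 * n + k + 1) * k.factorial * (2 * n + k + 1).factorial := by gcongr
    _ = _ := by ring

theorem abs_padeInt_mul_exp_sub_le (n : ℕ) :
    |(padeInt (-3) n : ℝ) * Real.exp 3 - padeInt 3 n| ≤
      3 * Real.exp 3 * ((3 / 2) ^ (2 * n) / n.factorial) := by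
  have h := hasSum_remTerm hasSum_real_exp_three n
  have h0 : 0 ≤ (-1 : ℝ) ^ n * (padeInt (-3) n * Real.exp 3 - padeInt 3 n) :=
    h.nonneg fun k => by rw [remTerm]; positivity
  have h1 := hasSum_le (remTerm_real_le n) h (hasSum_real_exp_three.mul_left _)
  rw [← abs_of_nonneg h0, abs_mul, abs_pow, abs_neg, abs_one, one_pow, one_mul] at h1
  linarith

theorem rpow_half_le (n : ℕ) (hn : 1 ≤ n) :
    (3 : ℝ) ^ ((n : ℝ) / 2) ≤ 3 * n * 3 ^ padicValNat 3 n.factorial := by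
  have hL := sub_one_mul_padicValNat_factorial (p := 3) n
  have hs : (Nat.digits 3 n).sum ≤ (Nat.digits 3 n).length * 2 :=
    List.sum_le_card_nsmul _ _ fun d hd =>
      Nat.lt_succ_iff.mp (Nat.digits_lt_base (by norm_num) hd)
  have hlen := Nat.base_pow_length_digits_le 3 n (by norm_num) (by omega)
  have hle : (n : ℝ) / 2 ≤ (((Nat.digits 3 n).length + padicValNat 3 n.factorial : ℕ) : ℝ) := by
    rw [div_le_iff₀ (by norm_num)]
    exact_mod_cast (by omega :
      n ≤ ((Nat.digits 3 n).length + padicValNat 3 n.factorial) * 2)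
  refine (Real.rpow_le_rpow_of_exponent_le (by norm_num) hle).trans ?_
  rw [Real.rpow_natCast, pow_add]
  gcongr
  exact_mod_cast hlen

/-- The Padé approximant of order `n`, divided by the common power of `3`, is a short vector. -/
theorem memDilate_of_pade (n : ℕ) (hn : 1 ≤ n) {a b : ℤ}
    (ha : padeInt (-3) n = 3 ^ padicValNat 3 n.factorial * a)
    (hb : padeInt 3 n = 3 ^ padicValNat 3 n.factorial * b) :
    MemDilate n (9 * Real.exp 3 * n) a b := by
  set v := padicValNat 3 n.factorial with hv
  have hr := rpow_half_le n hn
  have hn0 : (0 : ℝ) < n := by exact_mod_cast hn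
  have h2 : (0 : ℝ) < n.factorial := by exact_mod_cast n.factorial_pos
  have hr0 : (0 : ℝ) < 3 ^ ((n : ℝ) / 2) := by positivity
  have h3v : (0 : ℝ) < 3 ^ v := by positivity
  have ha' : (padeInt (-3) n : ℝ) = 3 ^ v * a := by rw [ha]; push_cast; ring
  have hb' : (padeInt 3 n : ℝ) = 3 ^ v * b := by rw [hb]; push_cast; ring
  have hdiv : ∀ x y : ℝ, 0 ≤ y → 3 ^ v * x ≤ 3 * Real.exp 3 * (y / n.factorial) →
      x ≤ 9 * Real.exp 3 * n * (y / (n.factorial * (3 : ℝ) ^ ((n : ℝ) / 2))) := by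
    intro x y hy h
    have hx : x ≤ 3 * Real.exp 3 * (y / n.factorial) / 3 ^ v := by
      rw [le_div_iff₀ h3v]; linarith
    refine hx.trans ?_
    have e1 : 9 * Real.exp 3 * n * (y / (n.factorial * (3 : ℝ) ^ ((n : ℝ) / 2))) =
        3 * Real.exp 3 * (y / n.factorial) * (3 * n / (3 : ℝ) ^ ((n : ℝ) / 2)) := by
      field_simp
      ring
    rw [e1, div_eq_mul_one_div]
    refine mul_le_mul_of_nonneg_left ?_ (by positivity)
    rw [div_le_div_iff₀ h3v hr0]
    linarith
  refine ⟨hdiv _ _ (by positivity) ?_, hdiv _ _ (by positivity) ?_, ?_⟩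
  · have h := abs_padeInt_le (-3) n
    rw [ha', abs_mul, abs_of_pos h3v] at h
    refine h.trans ?_
    have e3 : |((-3 : ℤ) : ℝ)| = 3 := by norm_num
    rw [e3]
    have : (0 : ℝ) ≤ Real.exp 3 * ((2 * n).factorial / n.factorial) := by positivity
    linarith
  · have h := abs_padeInt_mul_exp_sub_le n
    rw [ha', hb', mul_assoc, ← mul_sub, abs_mul, abs_of_pos h3v] at h
    exact h
  · have h := norm_padeInt_mul_E3_sub_le n
    have h3 : ‖(3 : ℚ_[3])‖ = (3 : ℝ)⁻¹ := by simpa using Padic.norm_p (p := 3)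
    rw [ha, hb, norm_factorial_three, ← hv] at h
    push_cast at h
    rw [mul_assoc, ← mul_sub, norm_mul, norm_pow, h3, inv_pow] at h
    rw [zpow_neg, zpow_natCast]
    exact le_of_mul_le_mul_left h (by positivity)

theorem MemDilate.mono {n : ℕ} {l l' : ℝ} {a b : ℤ} (h : MemDilate n l a b) (hl : l ≤ l') :
    MemDilate n l' a b := by
  refine ⟨h.fst_le.trans ?_, h.rem_le.trans ?_, h.norm_le⟩ <;> gcongr

theorem MemDilate.of_succ {n : ℕ} (hn : 1 ≤ n) {l : ℝ} (hl : 0 ≤ l) {a b : ℤ}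
    (h : MemDilate (n + 1) l a b) : MemDilate n (l * (6 * n)) a b := by
  have h2 : (0 : ℝ) < n.factorial := by exact_mod_cast n.factorial_pos
  have hn1 : (1 : ℝ) ≤ n := by exact_mod_cast hn
  have hs : (1 : ℝ) ≤ 3 ^ ((1 : ℝ) / 2) := Real.one_le_rpow (by norm_num) (by norm_num)
  have hr : (3 : ℝ) ^ (((n + 1 : ℕ) : ℝ) / 2) = 3 ^ ((n : ℝ) / 2) * 3 ^ ((1 : ℝ) / 2) := by
    rw [← Real.rpow_add (by norm_num)]
    push_cast
    ring_nf
  have hr0 : (0 : ℝ) < 3 ^ ((n : ℝ) / 2) := by positivity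
  refine ⟨h.fst_le.trans ?_, h.rem_le.trans ?_, h.norm_le.trans ?_⟩
  · rw [mul_assoc, hr]
    refine mul_le_mul_of_nonneg_left ?_ hl
    rw [show 2 * (n + 1) = 2 * n + 1 + 1 by ring, Nat.factorial_succ (2 * n + 1),
      Nat.factorial_succ (2 * n), Nat.factorial_succ n, mul_div_assoc',
      div_le_div_iff₀ (by positivity) (by positivity)]
    push_cast
    have : (4 * n + 2 : ℝ) ≤ 6 * n * 3 ^ ((1 : ℝ) / 2) := by nlinarith
    calc (2 * n + 1 + 1 : ℝ) * ((2 * n + 1) * (2 * n).factorial) *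
          (n.factorial * 3 ^ ((n : ℝ) / 2))
        = (4 * n + 2) * ((n + 1) * (2 * n).factorial * n.factorial * 3 ^ ((n : ℝ) / 2)) := by ring
      _ ≤ 6 * n * 3 ^ ((1 : ℝ) / 2) *
          ((n + 1) * (2 * n).factorial * n.factorial * 3 ^ ((n : ℝ) / 2)) := by gcongr
      _ = _ := by ring
  · rw [mul_assoc, hr]
    refine mul_le_mul_of_nonneg_left ?_ hl
    rw [show 2 * (n + 1) = 2 * n + 2 by ring, pow_add (3 / 2 : ℝ), Nat.factorial_succ n,
      mul_div_assoc', div_le_div_iff₀ (by positivity) (by positivity)]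
    push_cast
    have : ((3 / 2) ^ 2 : ℝ) ≤ 6 * n * ((n + 1) * 3 ^ ((1 : ℝ) / 2)) := by
      have : (1 : ℝ) ≤ (n + 1) * 3 ^ ((1 : ℝ) / 2) := one_le_mul_of_one_le_of_one_le (by linarith) hs
      nlinarith
    calc (3 / 2 : ℝ) ^ (2 * n) * (3 / 2) ^ 2 * (n.factorial * 3 ^ ((n : ℝ) / 2))
        = (3 / 2) ^ 2 * ((3 / 2 : ℝ) ^ (2 * n) * (n.factorial * 3 ^ ((n : ℝ) / 2))) := by ring
      _ ≤ 6 * n * ((n + 1) * 3 ^ ((1 : ℝ) / 2)) *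
          ((3 / 2 : ℝ) ^ (2 * n) * (n.factorial * 3 ^ ((n : ℝ) / 2))) := by gcongr
      _ = _ := by ring
  · exact zpow_le_zpow_right₀ (by norm_num) (by push_cast; omega)

theorem exists_memDilate_pair (n : ℕ) (hn : 1 ≤ n) :
    ∃ a b a' b' : ℤ, MemDilate n (108 * Real.exp 3 * (n : ℝ) ^ 2) a b ∧
      MemDilate n (108 * Real.exp 3 * (n : ℝ) ^ 2) a' b' ∧ a * b' - b * a' ≠ 0 := by
  have hz : ‖((3 : ℤ) : ℚ_[3])‖ ≤ ‖(3 : ℚ_[3])‖ := by simp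
  have hz' : ‖((-3 : ℤ) : ℚ_[3])‖ ≤ ‖(3 : ℚ_[3])‖ := by simp
  obtain ⟨a, ha⟩ := pow_padicValNat_dvd_padeInt (-3) hz' n
  obtain ⟨b, hb⟩ := pow_padicValNat_dvd_padeInt 3 hz n
  obtain ⟨a', ha'⟩ := pow_padicValNat_dvd_padeInt (-3) hz' (n + 1)
  obtain ⟨b', hb'⟩ := pow_padicValNat_dvd_padeInt 3 hz (n + 1)
  have hn1 : (1 : ℝ) ≤ n := by exact_mod_cast hn
  have he := Real.exp_pos 3
  refine ⟨a, b, a', b', (memDilate_of_pade n hn ha hb).mono ?_,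
    ((memDilate_of_pade (n + 1) (by omega) ha' hb').of_succ hn (by positivity)).mono ?_, ?_⟩
  · have : (n : ℝ) ≤ n ^ 2 := by nlinarith
    nlinarith [mul_le_mul_of_nonneg_left this he.le]
  · push_cast
    have : ((n : ℝ) + 1) * n ≤ 2 * n ^ 2 := by nlinarith
    nlinarith [mul_le_mul_of_nonneg_left this he.le]
  · intro h
    have hd := padeInt_det 3 n
    rw [ha, hb, ha', hb'] at hd
    have h0 : (2 * 3 * (-3 ^ 2) ^ n : ℤ) ≠ 0 := by positivity
    apply h0
    rw [← hd]
    linear_combination (3 ^ padicValNat 3 n.factorial * 3 ^ padicValNat 3 (n + 1).factorial : ℤ) * h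

theorem one_le_two_mul_of_det_ne_zero {n : ℕ} {l l' : ℝ} (hl : 0 ≤ l) (hl' : 0 ≤ l') {a b a' b' : ℤ}
    (h : MemDilate n l a b) (h' : MemDilate n l' a' b') (hd : a * b' - b * a' ≠ 0) :
    1 ≤ 2 * l * l' := by
  have hdvd : (3 : ℤ) ^ n ∣ a * b' - b * a' := by
    have := (Padic.norm_int_le_pow_iff_dvd (p := 3) (a * b' - b * a') n).mp ?_
    · simpa using this
    have e : ((a * b' - b * a' : ℤ) : ℚ_[3]) =
        (a' : ℚ_[3]) * (a * E3 - b) + -(a * (a' * E3 - b')) := by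
      push_cast
      ring
    rw [e]
    refine (Padic.nonarchimedean _ _).trans (max_le ?_ ?_)
    · rw [norm_mul]
      exact (mul_le_of_le_one_left (norm_nonneg _) (Padic.norm_int_le_one _)).trans
        (by simpa using h.norm_le)
    · rw [norm_neg, norm_mul]
      exact (mul_le_of_le_one_left (norm_nonneg _) (Padic.norm_int_le_one _)).trans
        (by simpa using h'.norm_le)
  have hlow : (3 : ℝ) ^ n ≤ |(a : ℝ) * b' - b * a'| := by
    have := Int.le_of_dvd (abs_pos.mpr hd) ((dvd_abs _ _).mpr hdvd)
    exact_mod_cast this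
  set X : ℝ := (2 * n).factorial / (n.factorial * (3 : ℝ) ^ ((n : ℝ) / 2)) with hX
  set Y : ℝ := (3 / 2 : ℝ) ^ (2 * n) / (n.factorial * (3 : ℝ) ^ ((n : ℝ) / 2)) with hY
  have hX0 : 0 ≤ X := by positivity
  have hY0 : 0 ≤ Y := by positivity
  have hup : |(a : ℝ) * b' - b * a'| ≤ 2 * l * l' * (X * Y) := by
    have e : (a : ℝ) * b' - b * a' =
        a' * (a * Real.exp 3 - b) - a * (a' * Real.exp 3 - b') := by ring
    rw [e]
    refine (abs_sub _ _).trans ?_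
    rw [abs_mul, abs_mul]
    have h1 := mul_le_mul h'.fst_le h.rem_le (abs_nonneg _) (by positivity)
    have h2 := mul_le_mul h.fst_le h'.rem_le (abs_nonneg _) (by positivity)
    linarith
  have hXY : X * Y ≤ 3 ^ n := by
    have h2 : (0 : ℝ) < n.factorial := by exact_mod_cast n.factorial_pos
    have hr0 : (0 : ℝ) < 3 ^ ((n : ℝ) / 2) := by positivity
    have hr : (3 : ℝ) ^ ((n : ℝ) / 2) * 3 ^ ((n : ℝ) / 2) = 3 ^ n := by
      rw [← Real.rpow_add (by norm_num), add_halves, Real.rpow_natCast]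
    have hc := Nat.add_choose_mul_factorial_mul_factorial n n
    rw [← two_mul] at hc
    have hc' : ((2 * n).factorial : ℝ) = (2 * n).choose n * n.factorial * n.factorial := by
      exact_mod_cast hc.symm
    have hb : ((2 * n).choose n : ℝ) ≤ 4 ^ n := by
      have := Nat.centralBinom_le_four_pow n
      rw [Nat.centralBinom] at this
      exact_mod_cast this
    rw [hX, hY, div_mul_div_comm, div_le_iff₀ (by positivity), hc']
    calc ((2 * n).choose n : ℝ) * n.factorial * n.factorial * (3 / 2) ^ (2 * n)
        ≤ 4 ^ n * n.factorial * n.factorial * (3 / 2) ^ (2 * n) := by gcongr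
      _ = 3 ^ n * 3 ^ n * (n.factorial * n.factorial) := by
        rw [pow_mul, ← mul_pow 3 3,
          show (3 * 3 : ℝ) = 4 * (3 / 2) ^ 2 by norm_num, mul_pow]
        ring
      _ = _ := by rw [← hr]; ring
  have h3 : (0 : ℝ) < 3 ^ n := by positivity
  have hll : 0 ≤ 2 * l * l' := by positivity
  refine le_of_mul_le_mul_right ?_ h3
  rw [one_mul]
  exact hlow.trans (hup.trans (by gcongr))

theorem linearIndependent_pair_of_det_ne_zero {x y x' y' : ℝ} (h : x * y' - y * x' ≠ 0) :
    LinearIndependent ℚ ![((x, y) : ℝ × ℝ), (x', y')] := by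
  rw [LinearIndependent.pair_iff]
  intro s t hst
  simp only [Rat.smul_def, Prod.ext_iff, Prod.smul_mk, Prod.mk_add_mk,
    Prod.fst_zero, Prod.snd_zero] at hst
  obtain ⟨h1, h2⟩ := hst
  constructor
  · have : (s : ℝ) * (x * y' - y * x') = 0 := by linear_combination y' * h1 - x' * h2
    simpa [h] using this
  · have : (t : ℝ) * (x * y' - y * x') = 0 := by linear_combination x * h2 - y * h1
    simpa [h] using this

/-- There is a constant `c > 1` with
`(c n²)⁻¹ ≤ λ₁(C_n, Λ_n) ≤ λ₂(C_n, Λ_n) ≤ c n²` for every `n ≥ 1`. -/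
theorem stmt1 : ∃ c : ℝ, 1 < c ∧ ∀ n : ℕ, 1 ≤ n →
    (c * (n : ℝ) ^ 2)⁻¹ ≤ lambdaMin (Cbody n) (Lat3 n) 1 ∧
    lambdaMin (Cbody n) (Lat3 n) 1 ≤ lambdaMin (Cbody n) (Lat3 n) 2 ∧
    lambdaMin (Cbody n) (Lat3 n) 2 ≤ c * (n : ℝ) ^ 2 := by
  have hexp : (1 : ℝ) < Real.exp 3 := Real.one_lt_exp_iff.mpr (by norm_num)
  refine ⟨2 * (108 * Real.exp 3), by linarith, fun n hn => ?_⟩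
  have hn0 : (0 : ℝ) < n := by exact_mod_cast hn
  obtain ⟨a, b, a', b', hab, hab', hd⟩ := exists_memDilate_pair n hn
  set L : ℝ := 108 * Real.exp 3 * (n : ℝ) ^ 2 with hL
  have hL0 : 0 < L := by positivity
  have hc : 2 * (108 * Real.exp 3) * (n : ℝ) ^ 2 = 2 * L := by rw [hL]; ring
  rw [hc]
  have hmem : L ∈ {l : ℝ | 0 < l ∧ ∃ T : Finset (ℝ × ℝ), ↑T ⊆ Lat3 n ∩ (l • Cbody n) ∧
      2 ≤ T.card ∧ LinearIndependent ℚ (fun v : T => (v : ℝ × ℝ))} := by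
    have hli : LinearIndependent ℚ ![(((a : ℝ), (b : ℝ)) : ℝ × ℝ), ((a' : ℝ), (b' : ℝ))] :=
      linearIndependent_pair_of_det_ne_zero (by exact_mod_cast hd)
    refine ⟨hL0, {((a : ℝ), (b : ℝ)), ((a' : ℝ), (b' : ℝ))}, ?_, ?_, ?_⟩
    · intro p hp
      rw [mem_lat_inter_smul_iff n hL0]
      simp only [Finset.coe_insert, Finset.coe_singleton, Set.mem_insert_iff,
        Set.mem_singleton_iff] at hp
      rcases hp with rfl | rfl
      exacts [⟨a, b, rfl, hab⟩, ⟨a', b', rfl, hab'⟩]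
    · rw [Finset.card_pair]
      simpa using hli.injective.ne (show (0 : Fin 2) ≠ 1 by decide)
    · refine hli.linearIndepOn_id' ?_
      simp [Set.pair_comm]
  have hbdd : ∀ i, BddBelow {l : ℝ | 0 < l ∧ ∃ T : Finset (ℝ × ℝ),
      ↑T ⊆ Lat3 n ∩ (l • Cbody n) ∧ i ≤ T.card ∧
      LinearIndependent ℚ (fun v : T => (v : ℝ × ℝ))} := fun i => ⟨0, fun l hl => hl.1.le⟩
  have hsub : {l : ℝ | 0 < l ∧ ∃ T : Finset (ℝ × ℝ), ↑T ⊆ Lat3 n ∩ (l • Cbody n) ∧ 2 ≤ T.card ∧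
      LinearIndependent ℚ (fun v : T => (v : ℝ × ℝ))} ⊆
      {l : ℝ | 0 < l ∧ ∃ T : Finset (ℝ × ℝ), ↑T ⊆ Lat3 n ∩ (l • Cbody n) ∧ 1 ≤ T.card ∧
      LinearIndependent ℚ (fun v : T => (v : ℝ × ℝ))} := by
    rintro l ⟨hl, T, hT, hcard, hli⟩
    exact ⟨hl, T, hT, by omega, hli⟩
  refine ⟨le_csInf ⟨L, hsub hmem⟩ ?_, csInf_le_csInf (hbdd 1) ⟨L, hmem⟩ hsub,
    (csInf_le (hbdd 2) hmem).trans (by linarith)⟩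
  rintro l ⟨hl, T, hT, hcard, hli⟩
  obtain ⟨p, hp⟩ := Finset.card_pos.mp hcard
  have hp0 : p ≠ 0 := hli.ne_zero ⟨p, hp⟩
  obtain ⟨x, y, rfl, hxy⟩ := (mem_lat_inter_smul_iff n hl p).mp (hT hp)
  have hbound : 1 ≤ 2 * l * L := by
    by_cases h1 : x * b - y * a = 0
    · refine one_le_two_mul_of_det_ne_zero hl.le hL0.le hxy hab' fun h2 => hp0 ?_
      have hx : x * (a * b' - b * a') = 0 := by linear_combination a * h2 - a' * h1
      have hy : y * (a * b' - b * a') = 0 := by linear_combination b * h2 - b' * h1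
      simp [(mul_eq_zero.mp hx).resolve_right hd, (mul_eq_zero.mp hy).resolve_right hd]
    · exact one_le_two_mul_of_det_ne_zero hl.le hL0.le hxy hab h1
  rw [inv_le_iff_one_le_mul₀ (by positivity)]
  linarith
end

section
/- Let p be a prime, δ = p^{−1/(p−1)}, and let F be a complete field of characteristic zero equipped with a multiplicative nonarchimedean absolute value ‖·‖ whose restriction to ℚ is the p-adic absolute value. Let α₁, …, α_s ∈ F be distinct, let n = (n₁, …, n_s) ∈ ℕ^s with N = n₁+⋯+n_s ≥ 1, and let i, j ∈ {1, …, s} be such that ρ := ‖α_i − α_j‖ satisfies 0 < ρ < δ. Then ‖P_n(α_i)·exp(α_j − α_i) − P_n(α_j)‖ ≤ (ρ/δ)·p²·N·∏_{k=1}^s max(‖α_i − α_k‖, ‖α_j − α_k‖)^{n_k}, where exp(x) = Σ_{m≥0} x^m/m!, a series that converges in F since ‖α_j − α_i‖ < δ. -/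
open Polynomial

/-- `f_m(z) = ∏ₖ (z − αₖ)^{mₖ}`. -/
noncomputable def fpoly {F : Type*} [Field F] {s : ℕ} (α : Fin s → F) (m : Fin s → ℕ) :
    F[X] := ∏ k, (X - C (α k)) ^ m k

/-- `P_m(z) = Σ_{j=0}^{M} f_m^{(j)}(z)`, the sum of `f_m` and all its derivatives. -/
noncomputable def Ppoly {F : Type*} [Field F] {s : ℕ} (α : Fin s → F) (m : Fin s → ℕ) :
    F[X] := ∑ j ∈ Finset.range (∑ k, m k + 1), derivative^[j] (fpoly α m)

/-- The exponential series `exp(x) = Σ_{m≥0} x^m/m!`. -/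
noncomputable def expF {F : Type*} [NormedField F] [CharZero F] (x : F) : F :=
  ∑' m : ℕ, x ^ m / (m.factorial : F)

/-- The `p`-adic absolute value of `n!` is `δ ^ (n - S n)`, where `δ ^ (p - 1) = 1 / p` and `S n` is
the sum of the `p`-adic digits of `n`. -/
lemma padicNorm_factorial_mul_pow_digits_sum {p : ℕ} (hp : p.Prime) {δ : ℝ}
    (hδ : δ ^ (p - 1) = (p : ℝ)⁻¹) (n : ℕ) :
    (padicNorm p (n.factorial : ℚ) : ℝ) * δ ^ (p.digits n).sum = δ ^ n := by
  have := Fact.mk hp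
  have hval := sub_one_mul_padicValNat_factorial (p := p) n
  have hle : (p.digits n).sum ≤ n := Nat.digit_sum_le p n
  have hne : (n.factorial : ℚ) ≠ 0 := by exact_mod_cast n.factorial_ne_zero
  rw [padicNorm.eq_zpow_of_nonzero hne, padicValRat.of_nat]
  have hpow : δ ^ (n - (p.digits n).sum) = ((p : ℝ)⁻¹) ^ padicValNat p n.factorial := by
    rw [← hval, pow_mul, hδ]
  rw [zpow_neg, zpow_natCast, Rat.cast_inv, Rat.cast_pow, Rat.cast_natCast, ← inv_pow, ← hpow, ← pow_add, Nat.sub_add_cancel hle]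

/-- The power of `δ` given by the digit sum of `m` is at least `1 / (p * N)` for `m ≤ N`. -/
lemma one_le_pow_digits_sum_mul {p : ℕ} (hp : p.Prime) {δ : ℝ} (hδ0 : 0 < δ) (hδ1 : δ ≤ 1)
    (hδ : δ ^ (p - 1) = (p : ℝ)⁻¹) {m N : ℕ} (hm : m ≤ N) (hN : 1 ≤ N) :
    1 ≤ δ ^ (p.digits m).sum * (p * N) := by
  have hp0 : (0 : ℝ) < p := by exact_mod_cast hp.pos
  have hsum : (p.digits m).sum ≤ (p - 1) * (p.digits m).length := by
    have := List.sum_le_card_nsmul (p.digits m) (p - 1) fun x hx =>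
      Nat.le_sub_one_of_lt (Nat.digits_lt_base hp.one_lt hx)
    simpa [mul_comm] using this
  have hlen : p ^ (p.digits m).length ≤ p * N := by
    rcases Nat.eq_zero_or_pos m with rfl | hm0
    · rw [Nat.digits_zero, List.length_nil, pow_zero]
      exact Nat.mul_pos hp.pos hN
    · exact (Nat.base_pow_length_digits_le p m hp.one_lt hm0.ne').trans
        (Nat.mul_le_mul_left p hm)
  have hlen' : (p : ℝ) ^ (p.digits m).length ≤ p * N := by exact_mod_cast hlen
  calc (1 : ℝ) = ((p : ℝ)⁻¹) ^ (p.digits m).length * (p : ℝ) ^ (p.digits m).length := by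
        rw [← mul_pow, inv_mul_cancel₀ hp0.ne', one_pow]
    _ ≤ δ ^ (p.digits m).sum * (p * N) := by
        rw [← hδ, ← pow_mul]
        exact mul_le_mul (pow_le_pow_of_le_one hδ0.le hδ1 hsum) hlen' (by positivity)
          (by positivity)

/-- Gauss norms of radius `r` over an ultrametric field are submultiplicative. -/
lemma norm_coeff_mul_mul_pow_le {F : Type*} [NormedField F] [IsUltrametricDist F] {r A B : ℝ}
    (hr : 0 ≤ r) (hA : 0 ≤ A) {f g : F[X]} (hf : ∀ m, ‖f.coeff m‖ * r ^ m ≤ A)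
    (hg : ∀ m, ‖g.coeff m‖ * r ^ m ≤ B) (m : ℕ) : ‖(f * g).coeff m‖ * r ^ m ≤ A * B := by
  rw [coeff_mul]
  obtain ⟨x, hx, hle⟩ := IsUltrametricDist.exists_norm_finsetSum_le_of_nonempty
    (t := Finset.HasAntidiagonal.antidiagonal m) ⟨(0, m), by simp [Finset.HasAntidiagonal.mem_antidiagonal]⟩ fun x => f.coeff x.1 * g.coeff x.2
  have hm : x.1 + x.2 = m := Finset.HasAntidiagonal.mem_antidiagonal.mp hx
  calc _ ≤ ‖f.coeff x.1 * g.coeff x.2‖ * r ^ m := by gcongr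
    _ = (‖f.coeff x.1‖ * r ^ x.1) * (‖g.coeff x.2‖ * r ^ x.2) := by
        rw [norm_mul, ← hm, pow_add]; ring
    _ ≤ A * B := mul_le_mul (hf _) (hg _) (by positivity) hA

lemma norm_coeff_one_mul_pow_le {F : Type*} [NormedField F] (r : ℝ) (m : ℕ) :
    ‖(1 : F[X]).coeff m‖ * r ^ m ≤ 1 := by
  rcases m with _ | m <;> simp [coeff_one]

lemma norm_coeff_pow_mul_pow_le {F : Type*} [NormedField F] [IsUltrametricDist F] {r A : ℝ}
    (hr : 0 ≤ r) (hA : 0 ≤ A) {f : F[X]} (hf : ∀ m, ‖f.coeff m‖ * r ^ m ≤ A) (n : ℕ) :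
    ∀ m, ‖(f ^ n).coeff m‖ * r ^ m ≤ A ^ n := by
  induction n with
  | zero => simpa using norm_coeff_one_mul_pow_le r
  | succ n ih =>
    rw [pow_succ, pow_succ]
    exact norm_coeff_mul_mul_pow_le hr (pow_nonneg hA n) ih hf

lemma norm_coeff_prod_mul_pow_le {F ι : Type*} [NormedField F] [IsUltrametricDist F] {r : ℝ}
    (hr : 0 ≤ r) (s : Finset ι) {A : ι → ℝ} (hA : ∀ k, 0 ≤ A k) {f : ι → F[X]}
    (hf : ∀ k m, ‖(f k).coeff m‖ * r ^ m ≤ A k) :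
    ∀ m, ‖(∏ k ∈ s, f k).coeff m‖ * r ^ m ≤ ∏ k ∈ s, A k := by
  classical
  induction s using Finset.induction_on with
  | empty => simpa using norm_coeff_one_mul_pow_le r
  | insert a s ha ih =>
    rw [Finset.prod_insert ha, Finset.prod_insert ha]
    exact norm_coeff_mul_mul_pow_le hr (hA a) (hf a) ih

/-- The Taylor coefficients of `∏ₖ (z - αₖ)^{nₖ}` at `a`, weighted by powers of a radius `r`. -/
lemma norm_taylor_fpoly_coeff_mul_pow_le {F : Type*} [NormedField F] [IsUltrametricDist F] {s : ℕ}
    (α : Fin s → F) (n : Fin s → ℕ) (a : F) {r : ℝ} (hr : 0 ≤ r) {A : Fin s → ℝ}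
    (hrA : ∀ k, r ≤ A k) (hA : ∀ k, ‖a - α k‖ ≤ A k) (m : ℕ) :
    ‖(taylor a (fpoly α n)).coeff m‖ * r ^ m ≤ ∏ k, A k ^ n k := by
  have hA0 : ∀ k, 0 ≤ A k := fun k => hr.trans (hrA k)
  have htaylor : taylor a (fpoly α n) = ∏ k, (X + C (a - α k)) ^ n k := by
    simp only [taylor_apply, fpoly, prod_comp, pow_comp, sub_comp, X_comp, C_comp, C_sub]
    simp only [add_sub_assoc]
  rw [htaylor]
  refine norm_coeff_prod_mul_pow_le hr _ (fun k => pow_nonneg (hA0 k) _) (fun k =>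
    norm_coeff_pow_mul_pow_le hr (hA0 k) (fun l => ?_) _) m
  rcases l with _ | _ | l
  · simpa using hA k
  · simpa [coeff_C] using hrA k
  · simpa [coeff_X, coeff_C] using hA0 k

lemma eval_iterate_derivative_eq_factorial_mul {F : Type*} [Field F] (f : F[X]) (a : F) (m : ℕ) :
    (derivative^[m] f).eval a = m.factorial * (taylor a f).coeff m := by
  rw [taylor_coeff, ← factorial_smul_hasseDeriv]
  simp

/-- Taylor's formula for the sum of all the derivatives of a polynomial. -/
lemma eval_sum_iterate_derivative_add {F : Type*} [Field F] [CharZero F] (f : F[X]) {N : ℕ}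
    (hf : f.natDegree ≤ N) (a h : F) :
    (∑ j ∈ Finset.range (N + 1), derivative^[j] f).eval (a + h) =
      ∑ m ∈ Finset.range (N + 1), (derivative^[m] f).eval a *
        ∑ k ∈ Finset.range (m + 1), h ^ k / (k.factorial : F) := by
  have hexpand : ∀ j ∈ Finset.range (N + 1), (derivative^[j] f).eval (a + h) =
      ∑ k ∈ Finset.range (N + 1 - j),
        (derivative^[j + k] f).eval a * (h ^ k / (k.factorial : F)) := by
    intro j hj
    have hdeg : (taylor a (derivative^[j] f)).natDegree < N + 1 - j := by
      have := natDegree_iterate_derivative f j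
      have := Finset.mem_range.mp hj
      rw [natDegree_taylor]; omega
    rw [add_comm a h, ← taylor_eval, eval_eq_sum_range' hdeg]
    refine Finset.sum_congr rfl fun k _ => ?_
    have hk : (k.factorial : F) ≠ 0 := by exact_mod_cast k.factorial_ne_zero
    rw [add_comm j k, Function.iterate_add_apply, eval_iterate_derivative_eq_factorial_mul]
    field_simp
  rw [eval_finsetSum, Finset.sum_congr rfl hexpand, ← Finset.sum_range_diag_flip (N + 1)
    fun j k => (derivative^[j + k] f).eval a * (h ^ k / (k.factorial : F))]
  refine Finset.sum_congr rfl fun m _ => ?_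
  rw [Finset.mul_sum, ← Finset.sum_range_reflect]
  refine Finset.sum_congr rfl fun k hk => ?_
  have := Finset.mem_range.mp hk
  rw [show m + 1 - 1 - k + (m - (m + 1 - 1 - k)) = m by omega,
    show m - (m + 1 - 1 - k) = k by omega]

lemma natDegree_fpoly_le {F : Type*} [Field F] {s : ℕ} (α : Fin s → F) (n : Fin s → ℕ) :
    (fpoly α n).natDegree ≤ ∑ k, n k := by
  refine (natDegree_prod_le _ _).trans (Finset.sum_le_sum fun k _ => ?_)
  simp

/-- Over a complete characteristic-zero field with a multiplicative
nonarchimedean absolute value restricting to the `p`-adic one on `ℚ`, with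
`δ = p^{−1/(p−1)}` and `0 < ρ = ‖αᵢ−αⱼ‖ < δ`:
`‖P_n(αᵢ)·exp(αⱼ−αᵢ) − P_n(αⱼ)‖ ≤ (ρ/δ) p² N ∏ₖ max(‖αᵢ−αₖ‖, ‖αⱼ−αₖ‖)^{nₖ}`. -/
theorem stmt11 {F : Type*} [NormedField F] [CharZero F] [CompleteSpace F]
    (p : ℕ) (hp : p.Prime)
    (hna : ∀ x y : F, ‖x + y‖ ≤ max ‖x‖ ‖y‖)
    (hQ : ∀ q : ℚ, ‖(q : F)‖ = (padicNorm p q : ℝ))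
    (δ : ℝ) (hδ : δ = (p : ℝ) ^ (-(1 : ℝ) / ((p : ℝ) - 1)))
    {s : ℕ} (α : Fin s → F) (hα : Function.Injective α)
    (n : Fin s → ℕ) (N : ℕ) (hN : N = ∑ k, n k) (hN1 : 1 ≤ N)
    (i j : Fin s) (ρ : ℝ) (hρ : ρ = ‖α i - α j‖)
    (hρ0 : 0 < ρ) (hρδ : ρ < δ) :
    ‖(Ppoly α n).eval (α i) * expF (α j - α i) - (Ppoly α n).eval (α j)‖ ≤
      ρ / δ * ((p : ℝ) ^ 2 * N * ∏ k, max ‖α i - α k‖ ‖α j - α k‖ ^ n k) := by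
  have : IsUltrametricDist F :=
    IsUltrametricDist.isUltrametricDist_of_forall_norm_add_le_max_norm hna
  have hp1 : (1 : ℝ) < p := by exact_mod_cast hp.one_lt
  have hp0 : (0 : ℝ) < p := by linarith
  have hδ0 : 0 < δ := hρ0.trans hρδ
  have hδpow : δ ^ (p - 1) = (p : ℝ)⁻¹ := by
    have hp1' : (p : ℝ) - 1 ≠ 0 := by linarith
    rw [hδ, ← Real.rpow_natCast, ← Real.rpow_mul hp0.le, Nat.cast_sub hp.one_le, Nat.cast_one,
      div_mul_cancel₀ _ hp1', Real.rpow_neg_one]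
  have hδ1 : δ ≤ 1 := by
    rw [hδ]
    exact Real.rpow_le_one_of_one_le_of_nonpos hp1.le
      (div_nonpos_of_nonpos_of_nonneg (by norm_num) (by linarith))
  set h : F := α j - α i with hh
  have hhρ : ‖h‖ = ρ := by rw [hρ, hh, norm_sub_rev]
  have hfact : ∀ m : ℕ, ‖(m.factorial : F)‖ * δ ^ (p.digits m).sum = δ ^ m := fun m => by
    have := hQ (m.factorial : ℚ)
    rw [Rat.cast_natCast] at this
    rw [this, padicNorm_factorial_mul_pow_digits_sum hp hδpow]
  have hfact0 : ∀ m : ℕ, 0 < ‖(m.factorial : F)‖ := fun m =>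
    norm_pos_iff.mpr (by exact_mod_cast m.factorial_ne_zero)
  have hterm : ∀ m : ℕ, ‖h ^ m / (m.factorial : F)‖ ≤ (ρ / δ) ^ m := fun m => by
    rw [norm_div, norm_pow, hhρ, div_pow, ← hfact m]
    refine div_le_div_of_nonneg_left (by positivity) (by have := hfact0 m; positivity) ?_
    exact mul_le_of_le_one_right (norm_nonneg _) (pow_le_one₀ hδ0.le hδ1)
  have hρδ1 : ρ / δ < 1 := (div_lt_one hδ0).mpr hρδ
  have hρδ0 : 0 ≤ ρ / δ := by positivity
  have hsummable : Summable fun m : ℕ => h ^ m / (m.factorial : F) :=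
    Summable.of_norm_bounded (summable_geometric_of_lt_one hρδ0 hρδ1) hterm
  have htail : ∀ m ≤ N, ‖(m.factorial : F) *
      (expF h - ∑ k ∈ Finset.range (m + 1), h ^ k / (k.factorial : F))‖ ≤
        ρ ^ m * (ρ / δ * (p ^ 2 * N)) := by
    intro m hm
    have hdigits := one_le_pow_digits_sum_mul hp hδ0 hδ1 hδpow hm hN1
    have hfactm : ‖(m.factorial : F)‖ ≤ δ ^ m * (p ^ 2 * N) := by
      calc ‖(m.factorial : F)‖
          ≤ ‖(m.factorial : F)‖ * (δ ^ (p.digits m).sum * (p * N)) :=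
            le_mul_of_one_le_right (norm_nonneg _) hdigits
        _ = δ ^ m * (p * N) := by rw [← mul_assoc, hfact]
        _ ≤ δ ^ m * (p ^ 2 * N) := by
            gcongr
            nlinarith
    rw [expF, ← hsummable.sum_add_tsum_nat_add (m + 1), add_sub_cancel_left, norm_mul]
    have htsum : ‖∑' k : ℕ, h ^ (k + (m + 1)) / ((k + (m + 1)).factorial : F)‖ ≤
        (ρ / δ) ^ (m + 1) :=
      IsUltrametricDist.norm_tsum_le_of_forall_le_of_nonneg (by positivity) fun k =>
        (hterm _).trans (pow_le_pow_of_le_one hρδ0 hρδ1.le (by omega))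
    calc _ ≤ δ ^ m * (p ^ 2 * N) * (ρ / δ) ^ (m + 1) := by gcongr
      _ = ρ ^ m * (ρ / δ * (p ^ 2 * N)) := by
          rw [pow_succ (ρ / δ), div_pow]
          field_simp
  have hρmax : ∀ k, ρ ≤ max ‖α i - α k‖ ‖α j - α k‖ := fun k => by
    rw [hρ]
    simpa [norm_sub_rev (α k) (α j)] using hna (α i - α k) (α k - α j)
  have hdiff : (Ppoly α n).eval (α i) * expF h - (Ppoly α n).eval (α j) =
      ∑ m ∈ Finset.range (∑ k, n k + 1), (taylor (α i) (fpoly α n)).coeff m *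
        ((m.factorial : F) *
          (expF h - ∑ k ∈ Finset.range (m + 1), h ^ k / (k.factorial : F))) := by
    have hj : α j = α i + h := by rw [hh]; ring
    rw [hj, Ppoly, eval_sum_iterate_derivative_add _ (natDegree_fpoly_le α n), eval_finsetSum,
      Finset.sum_mul, ← Finset.sum_sub_distrib]
    refine Finset.sum_congr rfl fun m _ => ?_
    rw [eval_iterate_derivative_eq_factorial_mul]
    ring
  rw [hdiff]
  have hprod : 0 ≤ ∏ k, max ‖α i - α k‖ ‖α j - α k‖ ^ n k :=
    Finset.prod_nonneg fun k _ => pow_nonneg (hρ0.le.trans (hρmax k)) _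
  refine IsUltrametricDist.norm_sum_le_of_forall_le_of_nonneg (by positivity) fun m hm => ?_
  have hmN : m ≤ N := by rw [hN]; exact Nat.lt_succ_iff.mp (Finset.mem_range.mp hm)
  have hcoeff := norm_taylor_fpoly_coeff_mul_pow_le α n (α i) hρ0.le hρmax
    (fun k => le_max_left _ _) m
  rw [norm_mul]
  calc _ ≤ ‖(taylor (α i) (fpoly α n)).coeff m‖ * (ρ ^ m * (ρ / δ * (p ^ 2 * N))) := by
        gcongr
        exact htail m hmN
    _ = (‖(taylor (α i) (fpoly α n)).coeff m‖ * ρ ^ m) * (ρ / δ * (p ^ 2 * N)) := by ring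
    _ ≤ (∏ k, max ‖α i - α k‖ ‖α j - α k‖ ^ n k) * (ρ / δ * (p ^ 2 * N)) := by gcongr
    _ = _ := by ring
end
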